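/- arXiv:1604.07737 — 3 statements merged into one kernel-verified Lean document; each statement's English description precedes it below -/
import Mathlib

section
/- Let u : [0,∞) → ℝ be such that its radial extension ũ(x) = u(|x|) belongs to C⁴(ℝ⁷), with ‖ũ‖ < ∞, and suppose lim_{ρ→∞} ρ³ |Δ_rad u(ρ)| = 0, lim_{ρ→∞} ρ³ |(Δ_rad u)'(ρ)| = 0, lim_{ρ→∞} ρ^{3/2} |u(ρ)| = 0, and lim_{ρ→∞} ρ^{5/2} |u'(ρ)| = 0. Then for each admissible α there is a constant C_α > 0, independent of u, such that: ‖ρ^α u‖_{L²(0,∞)} ≤ C_α ‖ũ‖ for α ∈ [0,1]; ‖ρ^α u'‖_{L²(0,∞)} ≤ C_α ‖ũ‖ for α ∈ [0,2]; ‖ρ^α u''‖_{L²(0,∞)} ≤ C_α ‖ũ‖ for α ∈ [1,3]; ‖ρ^α u⁽³⁾‖_{L²(0,∞)} ≤ C_α ‖ũ‖ for α ∈ [2,3]; and ‖ρ³ u⁽⁴⁾‖_{L²(0,∞)} ≤ C ‖ũ‖. -/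
open MeasureTheory Set Filter Topology
open scoped ENNReal

/-- The radial Laplacian on `ℝ⁷`: `Δ_rad u(ρ) = u''(ρ) + (6/ρ) u'(ρ)`. -/
noncomputable def radLap (u : ℝ → ℝ) (ρ : ℝ) : ℝ := deriv (deriv u) ρ + (6 / ρ) * deriv u ρ

/-- The square of the norm `‖ũ‖² = ‖Δũ‖²_{L²(ℝ⁷)} + ‖Δ²ũ‖²_{L²(ℝ⁷)}` in radial
coordinates (up to the constant `|𝕊⁶|`). -/
noncomputable def radHnormSq (u : ℝ → ℝ) : ℝ≥0∞ :=
  (∫⁻ ρ in Ioi (0:ℝ), ENNReal.ofReal ((radLap u ρ)^2 * ρ^6)) +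
  (∫⁻ ρ in Ioi (0:ℝ), ENNReal.ofReal ((radLap (radLap u) ρ)^2 * ρ^6))

/-- The hypotheses of Lemma 2.1: the radial extension of `u` is `C⁴(ℝ⁷)`, `‖ũ‖ < ∞`,
`ρ³|Δ_rad u| → 0`, `ρ³|(Δ_rad u)'| → 0`, `ρ^{3/2}|u| → 0` and `ρ^{5/2}|u'| → 0`
as `ρ → ∞`. -/
def Good (u : ℝ → ℝ) : Prop :=
  ContDiff ℝ 4 (fun x : EuclideanSpace ℝ (Fin 7) => u ‖x‖) ∧
  radHnormSq u < ⊤ ∧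
  Tendsto (fun ρ : ℝ => ρ^3 * |radLap u ρ|) atTop (𝓝 0) ∧
  Tendsto (fun ρ : ℝ => ρ^3 * |deriv (radLap u) ρ|) atTop (𝓝 0) ∧
  Tendsto (fun ρ : ℝ => ρ ^ ((3:ℝ)/2) * |u ρ|) atTop (𝓝 0) ∧
  Tendsto (fun ρ : ℝ => ρ ^ ((5:ℝ)/2) * |deriv u ρ|) atTop (𝓝 0)


lemma ibp_aux (G H F F' : ℝ → ℝ) (hG : ContinuousOn G (Ioi 0)) (hH : ContinuousOn H (Ioi 0))
    (hF' : ContinuousOn F' (Ioi 0)) (hF : ∀ x ∈ Ioi (0:ℝ), HasDerivAt F (F' x) x)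
    (hle : ∀ x ∈ Ioi (0:ℝ), G x ≤ F' x + H x)
    (hG0 : ∀ x ∈ Ioi (0:ℝ), 0 ≤ G x) (hH0 : ∀ x ∈ Ioi (0:ℝ), 0 ≤ H x)
    (h0 : Tendsto F (𝓝[>] 0) (𝓝 0)) (hi : Tendsto F atTop (𝓝 0)) :
    ∫⁻ x in Ioi (0:ℝ), ENNReal.ofReal (G x) ≤ ∫⁻ x in Ioi (0:ℝ), ENNReal.ofReal (H x) := by
  have hmG : AEMeasurable (fun x => ENNReal.ofReal (G x)) (volume.restrict (Ioi (0:ℝ))) :=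
    (hG.aemeasurable measurableSet_Ioi).ennreal_ofReal
  set a : ℕ → ℝ := fun n => 1 / ((n:ℝ) + 1) with ha
  set b : ℕ → ℝ := fun n => (n:ℝ) + 1 with hb
  have ha0 : Tendsto a atTop (𝓝 0) := tendsto_one_div_add_atTop_nhds_zero_nat
  have hapos : ∀ n, 0 < a n := fun n => by simp only [ha]; positivity
  have hbt : Tendsto b atTop atTop :=
    tendsto_atTop_add_const_right _ _ tendsto_natCast_atTop_atTop
  have hab : ∀ n, a n ≤ b n := fun n => by
    have h1 : (1:ℝ) ≤ (n:ℝ) + 1 := by linarith [Nat.cast_nonneg (α := ℝ) n]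
    simp only [ha, hb]
    rw [div_le_iff₀ (by linarith)]
    nlinarith
  have cov : AECover (volume.restrict (Ioi (0:ℝ))) atTop (fun n => Ioc (a n) (b n)) := by
    refine ⟨?_, fun n => measurableSet_Ioc⟩
    rw [ae_restrict_iff' measurableSet_Ioi]
    refine Eventually.of_forall fun x hx => ?_
    filter_upwards [ha0.eventually (gt_mem_nhds hx), hbt.eventually (eventually_ge_atTop x)]
      with n h1 h2 using ⟨h1, h2⟩
  have lim := cov.lintegral_tendsto_of_countably_generated hmG
  have limR : Tendsto (fun n => ENNReal.ofReal (F (b n) - F (a n)) +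
      ∫⁻ x in Ioi (0:ℝ), ENNReal.ofReal (H x)) atTop
      (𝓝 (ENNReal.ofReal (0 - 0) + ∫⁻ x in Ioi (0:ℝ), ENNReal.ofReal (H x))) := by
    refine Tendsto.add (ENNReal.tendsto_ofReal ?_) tendsto_const_nhds
    refine (hi.comp hbt).sub (h0.comp ?_)
    exact tendsto_nhdsWithin_iff.2 ⟨ha0, Eventually.of_forall hapos⟩
  rw [sub_zero, ENNReal.ofReal_zero, zero_add] at limR
  refine le_of_tendsto_of_tendsto' lim limR fun n => ?_
  have hsub : Ioc (a n) (b n) ⊆ Ioi 0 := fun x hx => (hapos n).trans hx.1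
  have hsub' : Icc (a n) (b n) ⊆ Ioi 0 := fun x hx => (hapos n).trans_le hx.1
  rw [Measure.restrict_restrict measurableSet_Ioc, inter_eq_left.2 hsub]
  have iG : IntervalIntegrable G volume (a n) (b n) :=
    (hG.mono (by rwa [uIcc_of_le (hab n)])).intervalIntegrable
  have iH : IntervalIntegrable H volume (a n) (b n) :=
    (hH.mono (by rwa [uIcc_of_le (hab n)])).intervalIntegrable
  have iF : IntervalIntegrable F' volume (a n) (b n) :=
    (hF'.mono (by rwa [uIcc_of_le (hab n)])).intervalIntegrable
  have e1 : ∫ x in (a n)..(b n), F' x = F (b n) - F (a n) :=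
    intervalIntegral.integral_eq_sub_of_hasDerivAt
      (fun x hx => hF x (hsub' (by rwa [uIcc_of_le (hab n)] at hx))) iF
  have e2 : ∫ x in (a n)..(b n), G x ≤ ∫ x in (a n)..(b n), (F' x + H x) :=
    intervalIntegral.integral_mono_on (hab n) iG (iF.add iH) (fun x hx => hle x (hsub' hx))
  rw [intervalIntegral.integral_add iF iH, e1] at e2
  have nn : ∀ K : ℝ → ℝ, (∀ x ∈ Ioi (0:ℝ), 0 ≤ K x) →
      IntervalIntegrable K volume (a n) (b n) →
      ∫⁻ x in Ioc (a n) (b n), ENNReal.ofReal (K x) =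
        ENNReal.ofReal (∫ x in (a n)..(b n), K x) := by
    intro K hK iK
    rw [intervalIntegral.integral_of_le (hab n), ofReal_integral_eq_lintegral_ofReal]
    · exact (intervalIntegrable_iff_integrableOn_Ioc_of_le (hab n)).1 iK
    · exact (ae_restrict_iff' measurableSet_Ioc).2 (Eventually.of_forall fun x hx => hK x (hsub hx))
  rw [nn G hG0 iG]
  calc ENNReal.ofReal (∫ x in (a n)..(b n), G x)
      ≤ ENNReal.ofReal (F (b n) - F (a n) + ∫ x in (a n)..(b n), H x) :=
        ENNReal.ofReal_le_ofReal e2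
    _ ≤ ENNReal.ofReal (F (b n) - F (a n)) + ENNReal.ofReal (∫ x in (a n)..(b n), H x) :=
        ENNReal.ofReal_add_le
    _ ≤ _ := by
        rw [← nn H hH0 iH]
        gcongr

structure Reg (u : ℝ → ℝ) (w w1 z : ℝ → ℝ) : Prop where
  d0 : ∀ x > 0, HasDerivAt u (deriv u x) x
  d1 : ∀ x > 0, HasDerivAt (deriv u) (w x - 6 / x * deriv u x) x
  d2 : ∀ x > 0, HasDerivAt w (w1 x) x
  d3 : ∀ x > 0, HasDerivAt w1 (z x - 6 / x * w1 x) x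
  cz : ContinuousOn z (Ioi 0)
  l0 : Tendsto (fun x => x * u x ^ 2) (𝓝[>] 0) (𝓝 0)
  l1 : Tendsto (fun x => x * deriv u x ^ 2) (𝓝[>] 0) (𝓝 0)
  l2 : Tendsto (fun x => x ^ 3 * w x ^ 2) (𝓝[>] 0) (𝓝 0)
  l3 : Tendsto (fun x => x ^ 5 * w1 x ^ 2) (𝓝[>] 0) (𝓝 0)
  l4 : Tendsto (fun x => x ^ 6 * (w x * w1 x)) (𝓝[>] 0) (𝓝 0)

lemma reg_of_contDiff (u : ℝ → ℝ)
    (hu : ContDiff ℝ 4 (fun x : EuclideanSpace ℝ (Fin 7) => u ‖x‖)) :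
    Reg u (radLap u) (deriv (radLap u)) (radLap (radLap u)) := by
  obtain ⟨g, hg, hgu⟩ : ∃ g : ℝ → ℝ, ContDiff ℝ 4 g ∧ ∀ x > 0, u x = g x := by
    refine ⟨fun t => u ‖t • (EuclideanSpace.single (0 : Fin 7) (1:ℝ))‖,
      hu.comp (contDiff_id.smul contDiff_const), fun x hx => ?_⟩
    simp [norm_smul, abs_of_pos hx]
  have c1 : ContDiff ℝ 3 (deriv g) := (contDiff_succ_iff_deriv (n := 3).1 hg).2.2
  have c2 : ContDiff ℝ 2 (deriv (deriv g)) := (contDiff_succ_iff_deriv (n := 2).1 c1).2.2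
  have c3 : ContDiff ℝ 1 (deriv (deriv (deriv g))) := (contDiff_succ_iff_deriv (n := 1).1 c2).2.2
  have k4 : Continuous (deriv (deriv (deriv (deriv g)))) := c3.continuous_deriv le_rfl
  have h0 : ∀ x, HasDerivAt g (deriv g x) x := fun x =>
    (hg.differentiable (by norm_num) x).hasDerivAt
  have h1 : ∀ x, HasDerivAt (deriv g) (deriv (deriv g) x) x := fun x =>
    (c1.differentiable (by norm_num) x).hasDerivAt
  have h2 : ∀ x, HasDerivAt (deriv (deriv g)) (deriv (deriv (deriv g)) x) x := fun x =>
    (c2.differentiable (by norm_num) x).hasDerivAt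
  have h3 : ∀ x, HasDerivAt (deriv (deriv (deriv g))) (deriv (deriv (deriv (deriv g))) x) x :=
    fun x => (c3.differentiable (by norm_num) x).hasDerivAt
  have k0 := hg.continuous
  have k1 := c1.continuous
  have k2 := c2.continuous
  have k3 := c3.continuous
  generalize deriv (deriv (deriv (deriv g))) = g4 at *
  generalize deriv (deriv (deriv g)) = g3 at *
  generalize deriv (deriv g) = g2 at *
  generalize deriv g = g1 at *
  have tr : ∀ {f k : ℝ → ℝ} {d x : ℝ}, x > 0 → (∀ y > 0, f y = k y) → HasDerivAt k d x →
      HasDerivAt f d x := by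
    intro f k d x hx hfk hk
    refine hk.congr_of_eventuallyEq ?_
    filter_upwards [lt_mem_nhds hx] with y hy using hfk y hy
  have E0 : ∀ x > 0, HasDerivAt u (g1 x) x := fun x hx => tr hx hgu (h0 x)
  have e1 : ∀ x > 0, deriv u x = g1 x := fun x hx => (E0 x hx).deriv
  have E1 : ∀ x > 0, HasDerivAt (deriv u) (g2 x) x := fun x hx => tr hx e1 (h1 x)
  have ew : ∀ x > 0, radLap u x = g2 x + 6 / x * g1 x := fun x hx => by
    rw [radLap, (E1 x hx).deriv, e1 x hx]
  have E2 : ∀ x > 0, HasDerivAt (radLap u) (g3 x + 6 / x * g2 x - 6 / x ^ 2 * g1 x) x := by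
    intro x hx
    refine tr hx ew ?_
    have := (h2 x).add (((hasDerivAt_const x (6:ℝ)).div (hasDerivAt_id x) hx.ne').mul (h1 x))
    refine this.congr_deriv ?_
    simp
    ring
  have ew1 : ∀ x > 0, deriv (radLap u) x = g3 x + 6 / x * g2 x - 6 / x ^ 2 * g1 x :=
    fun x hx => (E2 x hx).deriv
  have E3 : ∀ x > 0, HasDerivAt (deriv (radLap u))
      (g4 x + 6 / x * g3 x - 12 / x ^ 2 * g2 x + 12 / x ^ 3 * g1 x) x := by
    intro x hx
    refine tr hx ew1 ?_
    have := ((h3 x).add (((hasDerivAt_const x (6:ℝ)).div (hasDerivAt_id x) hx.ne').mul (h2 x))).sub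
      (((hasDerivAt_const x (6:ℝ)).div (hasDerivAt_pow 2 x) (pow_pos hx 2).ne').mul (h1 x))
    refine this.congr_deriv ?_
    simp
    field_simp
    ring
  have ez : ∀ x > 0, radLap (radLap u) x =
      g4 x + 6 / x * g3 x - 12 / x ^ 2 * g2 x + 12 / x ^ 3 * g1 x
      + 6 / x * (g3 x + 6 / x * g2 x - 6 / x ^ 2 * g1 x) := fun x hx => by
    rw [radLap, (E3 x hx).deriv, ew1 x hx]
  have lim : ∀ f k : ℝ → ℝ, Continuous k → k 0 = 0 → (∀ x > 0, f x = k x) →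
      Tendsto f (𝓝[>] 0) (𝓝 0) := by
    intro f k hk hk0 hfk
    have : Tendsto k (𝓝[>] 0) (𝓝 0) := by
      have := (hk.tendsto 0).mono_left (nhdsWithin_le_nhds (s := Ioi 0))
      rwa [hk0] at this
    refine this.congr' ?_
    filter_upwards [self_mem_nhdsWithin] with x hx using (hfk x hx).symm
  refine ⟨fun x hx => ?_, fun x hx => ?_, fun x hx => ?_, fun x hx => ?_, ?_, ?_, ?_, ?_, ?_, ?_⟩
  · rw [e1 x hx]; exact E0 x hx
  · convert E1 x hx using 1
    rw [ew x hx, e1 x hx]; ring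
  · rw [ew1 x hx]; exact E2 x hx
  · convert E3 x hx using 1
    rw [ez x hx, ew1 x hx]; ring
  · have : ContinuousOn (fun x => g4 x + 6 / x * g3 x - 12 / x ^ 2 * g2 x + 12 / x ^ 3 * g1 x
      + 6 / x * (g3 x + 6 / x * g2 x - 6 / x ^ 2 * g1 x)) (Ioi 0) := by
      have n1 : ∀ x ∈ Ioi (0:ℝ), x ≠ 0 := fun x hx => ne_of_gt hx
      have n2 : ∀ x ∈ Ioi (0:ℝ), x ^ 2 ≠ 0 := fun x hx => pow_ne_zero _ (n1 x hx)
      have n3 : ∀ x ∈ Ioi (0:ℝ), x ^ 3 ≠ 0 := fun x hx => pow_ne_zero _ (n1 x hx)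
      fun_prop (disch := assumption)
    exact this.congr fun x hx => ez x hx
  · refine lim _ (fun x => x * g x ^ 2) (by fun_prop) (by simp) fun x hx => ?_
    rw [hgu x hx]
  · refine lim _ (fun x => x * g1 x ^ 2) (by fun_prop) (by simp) fun x hx => ?_
    rw [e1 x hx]
  · refine lim _ (fun x => x * (x * g2 x + 6 * g1 x) ^ 2) (by fun_prop) (by simp) fun x hx => ?_
    rw [ew x hx]; field_simp
  · refine lim _ (fun x => x * (x ^ 2 * g3 x + 6 * x * g2 x - 6 * g1 x) ^ 2)
      (by fun_prop) (by simp) fun x hx => ?_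
    rw [ew1 x hx]; field_simp
  · refine lim _ (fun x => x ^ 3 * ((x * g2 x + 6 * g1 x) *
      (x ^ 2 * g3 x + 6 * x * g2 x - 6 * g1 x))) (by fun_prop) (by simp) fun x hx => ?_
    rw [ew1 x hx, ew x hx]; field_simp

noncomputable def EE (u : ℝ → ℝ) (x : ℝ) : ℝ :=
  u x ^ 2 + x ^ 2 * u x ^ 2 + deriv u x ^ 2 + x ^ 4 * deriv u x ^ 2 + x ^ 2 * radLap u x ^ 2
  + x ^ 4 * deriv (radLap u) x ^ 2 + x ^ 6 * deriv (radLap u) x ^ 2 + x ^ 6 * radLap u x ^ 2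
  + x ^ 6 * radLap (radLap u) x ^ 2

lemma energy (u : ℝ → ℝ) (hu : Good u) :
    ∫⁻ x in Ioi (0:ℝ), ENNReal.ofReal (EE u x) ≤ ENNReal.ofReal 4 * radHnormSq u := by
  obtain ⟨hc, -, i2, i3, i0, i1⟩ := hu
  have R := reg_of_contDiff u hc
  have hN : ENNReal.ofReal 4 * radHnormSq u = ∫⁻ x in Ioi (0:ℝ), ENNReal.ofReal
      (4 * (radLap u x ^ 2 * x ^ 6 + radLap (radLap u) x ^ 2 * x ^ 6)) := by
    have m : ∀ v : ℝ → ℝ, Measurable (radLap v) := fun v => by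
      unfold radLap
      exact (measurable_deriv _).add ((measurable_const.div measurable_id).mul (measurable_deriv _))
    have m1 := m u
    have m2 := m (radLap u)
    rw [radHnormSq, ← lintegral_add_left (by fun_prop), ← lintegral_const_mul _ (by fun_prop)]
    refine setLIntegral_congr_fun measurableSet_Ioi fun x hx => ?_
    have hx' : (0:ℝ) < x := hx
    rw [← ENNReal.ofReal_add (by positivity) (by positivity), ← ENNReal.ofReal_mul (by norm_num)]
  rw [hN]
  unfold EE
  generalize radLap (radLap u) = z at *
  generalize deriv (radLap u) = w1 at *
  generalize radLap u = w at *
  obtain ⟨d0, d1, d2, d3, cz, l0, l1, l2, l3, l4⟩ := R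
  generalize deriv u = v at *
  have k0 : ContinuousOn u (Ioi 0) := fun x hx => (d0 x hx).continuousAt.continuousWithinAt
  have k1 : ContinuousOn v (Ioi 0) := fun x hx => (d1 x hx).continuousAt.continuousWithinAt
  have k2 : ContinuousOn w (Ioi 0) := fun x hx => (d2 x hx).continuousAt.continuousWithinAt
  have k3 : ContinuousOn w1 (Ioi 0) := fun x hx => (d3 x hx).continuousAt.continuousWithinAt
  refine ibp_aux _ _ (fun x => 2 * (x * u x ^ 2 + x ^ 3 * u x ^ 2 - x * v x ^ 2 - x ^ 5 * v x ^ 2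
      + x ^ 3 * w x ^ 2 - x ^ 5 * w1 x ^ 2 + x ^ 6 * (w x * w1 x)))
    (fun x => 2 * ((u x ^ 2 + 2 * x * u x * v x) + (3 * x ^ 2 * u x ^ 2 + 2 * x ^ 3 * u x * v x)
      + (11 * v x ^ 2 - 2 * x * v x * w x) + (7 * x ^ 4 * v x ^ 2 - 2 * x ^ 5 * v x * w x)
      + (3 * x ^ 2 * w x ^ 2 + 2 * x ^ 3 * w x * w1 x)
      + (7 * x ^ 4 * w1 x ^ 2 - 2 * x ^ 5 * w1 x * z x)
      + (x ^ 6 * w1 x ^ 2 + x ^ 6 * w x * z x)))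
    (by fun_prop) (by fun_prop) (by fun_prop) ?_ ?_ ?_ ?_ ?_ ?_
  · intro x hx
    have hx' : x ≠ 0 := ne_of_gt hx
    have p : ∀ n : ℕ, HasDerivAt (fun y : ℝ => y ^ n) (n * x ^ (n - 1)) x := fun n =>
      hasDerivAt_pow n x
    have a0 := (d0 x hx).pow 2
    have a1 := (d1 x hx).pow 2
    have a2 := (d2 x hx).pow 2
    have a3 := (d3 x hx).pow 2
    have := (((((((((hasDerivAt_id x).mul a0).add ((p 3).mul a0)).sub ((hasDerivAt_id x).mul a1)).sub
      ((p 5).mul a1)).add ((p 3).mul a2)).sub ((p 5).mul a3)).add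
      ((p 6).mul ((d2 x hx).mul (d3 x hx))))).const_mul 2
    refine this.congr_deriv ?_
    simp
    field_simp
    ring
  · intro x hx
    nlinarith [sq_nonneg (u x + 2 * x * v x), sq_nonneg (x * u x + x ^ 2 * v x),
      sq_nonneg (v x - x * w x), sq_nonneg (x ^ 2 * v x - x ^ 3 * w x),
      sq_nonneg (x * w x + x ^ 2 * w1 x), sq_nonneg (x ^ 2 * w1 x - x ^ 3 * z x),
      sq_nonneg (x ^ 3 * w x + x ^ 3 * z x), sq_nonneg (v x - x ^ 2 * v x),
      sq_nonneg (u x), sq_nonneg (x * u x), sq_nonneg (v x), sq_nonneg (x ^ 2 * v x),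
      sq_nonneg (x * w x), sq_nonneg (x ^ 2 * w1 x), sq_nonneg (x ^ 3 * w1 x),
      sq_nonneg (x ^ 3 * w x), sq_nonneg (x ^ 3 * z x), mul_nonneg (sq_nonneg x) (sq_nonneg (v x)),
      sq_nonneg (v x + x ^ 2 * v x)]
  · intro x hx
    have : (0:ℝ) < x := hx
    positivity
  · intro x hx
    have : (0:ℝ) < x := hx
    positivity
  · have s1 : Tendsto (fun x : ℝ => x ^ 2) (𝓝[>] 0) (𝓝 0) := by
      have := ((continuous_pow 2).tendsto (0:ℝ)).mono_left (nhdsWithin_le_nhds (s := Ioi 0))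
      simpa using this
    have s2 : Tendsto (fun x : ℝ => x ^ 4) (𝓝[>] 0) (𝓝 0) := by
      have := ((continuous_pow 4).tendsto (0:ℝ)).mono_left (nhdsWithin_le_nhds (s := Ioi 0))
      simpa using this
    have := ((((((l0.add (s1.mul l0)).sub l1).sub (s2.mul l1)).add l2).sub l3).add l4).const_mul 2
    convert this using 1
    · ext x; ring
    · simp
  · have s : ∀ n : ℕ, n ≠ 0 → Tendsto (fun x : ℝ => (x ^ n)⁻¹) atTop (𝓝 0) := fun n hn =>
      (tendsto_pow_atTop hn).inv_tendsto_atTop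
    have j0 := i0.pow 2
    have j1 := i1.pow 2
    have j2 := i2.pow 2
    have j3 := i3.pow 2
    have j4 : Tendsto (fun x => x ^ 6 * (w x * w1 x)) atTop (𝓝 0) := by
      have := i2.mul i3
      rw [tendsto_zero_iff_abs_tendsto_zero]
      refine (this.congr fun x => ?_).trans (by simp)
      simp only [Function.comp, abs_mul, abs_pow]
      rw [show |x| ^ 6 = x ^ 6 from Even.pow_abs (by decide) x]
      ring
    have := (((((((s 2 two_ne_zero).mul j0).add j0).sub ((s 4 (by norm_num)).mul j1)).sub j1).add
      ((s 3 (by norm_num)).mul j2)).sub ((s 1 (by norm_num)).mul j3)).add j4 |>.const_mul 2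
    have e : (2 * ((0:ℝ) * 0 ^ 2 + 0 ^ 2 - 0 * 0 ^ 2 - 0 ^ 2 + 0 * 0 ^ 2 - 0 * 0 ^ 2 + 0)) = 0 := by
      norm_num
    rw [e] at this
    refine this.congr' ?_
    filter_upwards [eventually_gt_atTop (0:ℝ)] with x hx
    have q3 : (x ^ ((3:ℝ)/2)) ^ 2 = x ^ 3 := by
      rw [← Real.rpow_natCast, ← Real.rpow_mul hx.le, ← Real.rpow_natCast]; norm_num
    have q5 : (x ^ ((5:ℝ)/2)) ^ 2 = x ^ 5 := by
      rw [← Real.rpow_natCast, ← Real.rpow_mul hx.le, ← Real.rpow_natCast]; norm_num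
    simp only [mul_pow, sq_abs, q3, q5]
    field_simp

lemma bound (T : ℝ → ℝ) (u : ℝ → ℝ) (hu : Good u) (K : ℝ) (hK : 0 ≤ K)
    (h : ∀ x > 0, T x ≤ K * EE u x) :
    ∫⁻ x in Ioi (0:ℝ), ENNReal.ofReal (T x) ≤ ENNReal.ofReal (K * 4) * radHnormSq u := by
  calc ∫⁻ x in Ioi (0:ℝ), ENNReal.ofReal (T x)
      ≤ ∫⁻ x in Ioi (0:ℝ), ENNReal.ofReal K * ENNReal.ofReal (EE u x) := by
        refine setLIntegral_mono' measurableSet_Ioi fun x hx => ?_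
        rw [← ENNReal.ofReal_mul hK]
        exact ENNReal.ofReal_le_ofReal (h x hx)
    _ = ENNReal.ofReal K * ∫⁻ x in Ioi (0:ℝ), ENNReal.ofReal (EE u x) :=
        lintegral_const_mul' _ _ ENNReal.ofReal_ne_top
    _ ≤ ENNReal.ofReal K * (ENNReal.ofReal 4 * radHnormSq u) := by gcongr; exact energy u hu
    _ = _ := by rw [← mul_assoc, ← ENNReal.ofReal_mul hK]

lemma interp (x : ℝ) (hx : 0 < x) (α : ℝ) (p q : ℕ) (h1 : (p:ℝ) ≤ α) (h2 : α ≤ q) (t : ℝ) :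
    (x ^ α * t) ^ 2 ≤ (x ^ p * t) ^ 2 + (x ^ q * t) ^ 2 := by
  have hp : 0 < x ^ α := Real.rpow_pos_of_pos hx α
  rcases le_total 1 x with h | h
  · have : x ^ α ≤ x ^ q := by
      rw [← Real.rpow_natCast]; exact Real.rpow_le_rpow_of_exponent_le h h2
    have : (x ^ α * t) ^ 2 ≤ (x ^ q * t) ^ 2 := by
      rw [mul_pow, mul_pow]; gcongr
    nlinarith [sq_nonneg (x ^ p * t)]
  · have : x ^ α ≤ x ^ p := by
      rw [← Real.rpow_natCast]; exact Real.rpow_le_rpow_of_exponent_ge hx h h1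
    have : (x ^ α * t) ^ 2 ≤ (x ^ p * t) ^ 2 := by
      rw [mul_pow, mul_pow]; gcongr
    nlinarith [sq_nonneg (x ^ q * t)]

lemma iter_derivs (u : ℝ → ℝ) (hu : Good u) (x : ℝ) (hx : 0 < x) :
    x * iteratedDeriv 2 u x = x * radLap u x - 6 * deriv u x ∧
    x ^ 2 * iteratedDeriv 3 u x = x ^ 2 * deriv (radLap u) x - 6 * (x * radLap u x)
      + 42 * deriv u x ∧
    x ^ 3 * iteratedDeriv 4 u x = x ^ 3 * radLap (radLap u) x - 12 * (x ^ 2 * deriv (radLap u) x)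
      + 48 * (x * radLap u x) - 336 * deriv u x := by
  have R := reg_of_contDiff u hu.1
  generalize radLap (radLap u) = z at *
  generalize deriv (radLap u) = w1 at *
  generalize radLap u = w at *
  have tr : ∀ {f k : ℝ → ℝ} {d x : ℝ}, x > 0 → (∀ y > 0, f y = k y) → HasDerivAt k d x →
      HasDerivAt f d x := by
    intro f k d x hx hfk hk
    refine hk.congr_of_eventuallyEq ?_
    filter_upwards [lt_mem_nhds hx] with y hy using hfk y hy
  have i2 : ∀ y > 0, iteratedDeriv 2 u y = w y - 6 / y * deriv u y := fun y hy => by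
    rw [iteratedDeriv_succ, iteratedDeriv_one]; exact (R.d1 y hy).deriv
  have D2 : ∀ y > 0, HasDerivAt (iteratedDeriv 2 u)
      (w1 y - 6 / y * w y + 42 / y ^ 2 * deriv u y) y := by
    intro y hy
    refine tr hy i2 ?_
    have := (R.d2 y hy).sub
      (((hasDerivAt_const y (6:ℝ)).div (hasDerivAt_id y) (ne_of_gt hy)).mul (R.d1 y hy))
    refine this.congr_deriv ?_
    have : y ≠ 0 := ne_of_gt hy
    simp
    field_simp
    ring
  have i3 : ∀ y > 0, iteratedDeriv 3 u y = w1 y - 6 / y * w y + 42 / y ^ 2 * deriv u y :=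
    fun y hy => by rw [iteratedDeriv_succ]; exact (D2 y hy).deriv
  have D3 : ∀ y > 0, HasDerivAt (iteratedDeriv 3 u)
      (z y - 12 / y * w1 y + 48 / y ^ 2 * w y - 336 / y ^ 3 * deriv u y) y := by
    intro y hy
    refine tr hy i3 ?_
    have := ((R.d3 y hy).sub
      (((hasDerivAt_const y (6:ℝ)).div (hasDerivAt_id y) (ne_of_gt hy)).mul (R.d2 y hy))).add
      (((hasDerivAt_const y (42:ℝ)).div (hasDerivAt_pow 2 y) (pow_pos hy 2).ne').mul (R.d1 y hy))
    refine this.congr_deriv ?_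
    have : y ≠ 0 := ne_of_gt hy
    simp
    field_simp
    ring
  have i4 : iteratedDeriv 4 u x =
      z x - 12 / x * w1 x + 48 / x ^ 2 * w x - 336 / x ^ 3 * deriv u x := by
    rw [iteratedDeriv_succ]; exact (D3 x hx).deriv
  rw [i2 x hx, i3 x hx, i4]
  refine ⟨?_, ?_, ?_⟩ <;> field_simp

lemma sq3 (a b c : ℝ) : (a + b + c) ^ 2 ≤ 3 * (a ^ 2 + b ^ 2 + c ^ 2) := by
  nlinarith [sq_nonneg (a - b), sq_nonneg (a - c), sq_nonneg (b - c)]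

lemma sq4 (a b c d : ℝ) : (a + b + c + d) ^ 2 ≤ 4 * (a ^ 2 + b ^ 2 + c ^ 2 + d ^ 2) := by
  nlinarith [sq_nonneg (a - b), sq_nonneg (a - c), sq_nonneg (b - c), sq_nonneg (a - d),
    sq_nonneg (b - d), sq_nonneg (c - d)]

/-- The basic quantities controlled by `EE`. -/
lemma EE_bounds (u : ℝ → ℝ) (x : ℝ) (hx : 0 < x) :
    u x ^ 2 + (x * u x) ^ 2 ≤ EE u x ∧ deriv u x ^ 2 + (x ^ 2 * deriv u x) ^ 2 ≤ EE u x ∧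
    (x * deriv u x) ^ 2 ≤ EE u x ∧ (x * radLap u x) ^ 2 ≤ EE u x ∧
    (x ^ 2 * radLap u x) ^ 2 ≤ EE u x ∧ (x ^ 3 * radLap u x) ^ 2 ≤ EE u x ∧
    (x ^ 2 * deriv (radLap u) x) ^ 2 ≤ EE u x ∧ (x ^ 3 * deriv (radLap u) x) ^ 2 ≤ EE u x ∧
    (x ^ 3 * radLap (radLap u) x) ^ 2 ≤ EE u x := by
  unfold EE
  generalize radLap (radLap u) x = z at *
  generalize deriv (radLap u) x = w1 at *
  generalize radLap u x = w at *
  generalize deriv u x = v at *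
  generalize u x = y at *
  have h1 : 0 ≤ y ^ 2 := by positivity
  have h2 : 0 ≤ x ^ 2 * y ^ 2 := by positivity
  have h3 : 0 ≤ v ^ 2 := by positivity
  have h4 : 0 ≤ x ^ 4 * v ^ 2 := by positivity
  have h5 : 0 ≤ x ^ 2 * w ^ 2 := by positivity
  have h6 : 0 ≤ x ^ 4 * w1 ^ 2 := by positivity
  have h7 : 0 ≤ x ^ 6 * w1 ^ 2 := by positivity
  have h8 : 0 ≤ x ^ 6 * w ^ 2 := by positivity
  have h9 : 0 ≤ x ^ 6 * z ^ 2 := by positivity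
  have a1 : x ^ 2 * v ^ 2 ≤ v ^ 2 + x ^ 4 * v ^ 2 := by
    nlinarith [sq_nonneg (v - x ^ 2 * v)]
  have a2 : x ^ 4 * w ^ 2 ≤ x ^ 2 * w ^ 2 + x ^ 6 * w ^ 2 := by
    nlinarith [sq_nonneg (x * w - x ^ 3 * w)]
  refine ⟨?_, ?_, ?_, ?_, ?_, ?_, ?_, ?_, ?_⟩ <;> ring_nf at * <;> linarith


/-- Weighted `L²(0,∞)` bounds: `‖(·)^α u⁽ʲ⁾‖_{L²(ℝ⁺)} ≲_α ‖ũ‖` for the admissible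
ranges of `α` and `j = 0,…,4`. -/
theorem stmt3 :
    (∀ α : ℝ, α ∈ Icc (0:ℝ) 1 → ∃ C : ℝ, 0 < C ∧ ∀ u : ℝ → ℝ, Good u →
      (∫⁻ ρ in Ioi (0:ℝ), ENNReal.ofReal ((ρ ^ α * u ρ)^2))
        ≤ ENNReal.ofReal C * radHnormSq u) ∧
    (∀ α : ℝ, α ∈ Icc (0:ℝ) 2 → ∃ C : ℝ, 0 < C ∧ ∀ u : ℝ → ℝ, Good u →
      (∫⁻ ρ in Ioi (0:ℝ), ENNReal.ofReal ((ρ ^ α * deriv u ρ)^2))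
        ≤ ENNReal.ofReal C * radHnormSq u) ∧
    (∀ α : ℝ, α ∈ Icc (1:ℝ) 3 → ∃ C : ℝ, 0 < C ∧ ∀ u : ℝ → ℝ, Good u →
      (∫⁻ ρ in Ioi (0:ℝ), ENNReal.ofReal ((ρ ^ α * iteratedDeriv 2 u ρ)^2))
        ≤ ENNReal.ofReal C * radHnormSq u) ∧
    (∀ α : ℝ, α ∈ Icc (2:ℝ) 3 → ∃ C : ℝ, 0 < C ∧ ∀ u : ℝ → ℝ, Good u →
      (∫⁻ ρ in Ioi (0:ℝ), ENNReal.ofReal ((ρ ^ α * iteratedDeriv 3 u ρ)^2))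
        ≤ ENNReal.ofReal C * radHnormSq u) ∧
    (∃ C : ℝ, 0 < C ∧ ∀ u : ℝ → ℝ, Good u →
      (∫⁻ ρ in Ioi (0:ℝ), ENNReal.ofReal ((ρ ^ (3:ℝ) * iteratedDeriv 4 u ρ)^2))
        ≤ ENNReal.ofReal C * radHnormSq u) := by
  refine ⟨fun α hα => ⟨1 * 4, by norm_num, fun u hu => ?_⟩,
    fun α hα => ⟨1 * 4, by norm_num, fun u hu => ?_⟩,
    fun α hα => ⟨400 * 4, by norm_num, fun u hu => ?_⟩,
    fun α hα => ⟨20000 * 4, by norm_num, fun u hu => ?_⟩,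
    ⟨1000000 * 4, by norm_num, fun u hu => ?_⟩⟩
  all_goals
    refine bound _ u hu _ (by norm_num) fun x hx => ?_
    obtain ⟨b1, b2, b3, b4, b5, b6, b7, b8, b9⟩ := EE_bounds u x hx
    obtain ⟨d2, d3, d4⟩ := iter_derivs u hu x hx
  · refine (interp x hx α 0 1 (by simpa using hα.1) (by simpa using hα.2) _).trans ?_
    simpa using b1
  · refine (interp x hx α 0 2 (by simpa using hα.1) (by simpa using hα.2) _).trans ?_
    simpa using b2
  · refine (interp x hx α 1 3 (by simpa using hα.1) (by simpa using hα.2) _).trans ?_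
    have e : x ^ 3 * iteratedDeriv 2 u x = x ^ 3 * radLap u x + -6 * (x ^ 2 * deriv u x) + 0 := by
      linear_combination x ^ 2 * d2
    have e' : x * iteratedDeriv 2 u x = x * radLap u x + -6 * deriv u x + 0 := by
      linear_combination d2
    rw [pow_one, e, e']
    have s1 := sq3 (x ^ 3 * radLap u x) (-6 * (x ^ 2 * deriv u x)) 0
    have s2 := sq3 (x * radLap u x) (-6 * deriv u x) 0
    rw [mul_pow (-6)] at s1 s2
    linarith [sq_nonneg (deriv u x), sq_nonneg (x ^ 2 * deriv u x)]
  · refine (interp x hx α 2 3 (by simpa using hα.1) (by simpa using hα.2) _).trans ?_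
    have e : x ^ 3 * iteratedDeriv 3 u x =
        x ^ 3 * deriv (radLap u) x + -6 * (x ^ 2 * radLap u x) + 42 * (x * deriv u x) := by
      linear_combination x * d3
    have e' : x ^ 2 * iteratedDeriv 3 u x =
        x ^ 2 * deriv (radLap u) x + -6 * (x * radLap u x) + 42 * deriv u x := by
      linear_combination d3
    rw [e, e']
    have s1 := sq3 (x ^ 3 * deriv (radLap u) x) (-6 * (x ^ 2 * radLap u x)) (42 * (x * deriv u x))
    have s2 := sq3 (x ^ 2 * deriv (radLap u) x) (-6 * (x * radLap u x)) (42 * deriv u x)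
    rw [mul_pow (-6), mul_pow 42] at s1 s2
    linarith [sq_nonneg (deriv u x), sq_nonneg (x ^ 2 * deriv u x)]
  · have e : x ^ (3:ℝ) * iteratedDeriv 4 u x = x ^ 3 * radLap (radLap u) x
        + -12 * (x ^ 2 * deriv (radLap u) x) + 48 * (x * radLap u x) + -336 * deriv u x := by
      have : x ^ (3:ℝ) = x ^ 3 := by exact_mod_cast Real.rpow_natCast x 3
      rw [this]
      linear_combination d4
    simp only [e]
    have s1 := sq4 (x ^ 3 * radLap (radLap u) x) (-12 * (x ^ 2 * deriv (radLap u) x))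
      (48 * (x * radLap u x)) (-336 * deriv u x)
    rw [mul_pow (-12), mul_pow 48, mul_pow (-336)] at s1
    linarith [sq_nonneg (deriv u x), sq_nonneg (x ^ 2 * deriv u x)]
end

section
/- Let u : [0,∞) → ℝ be such that its radial extension ũ(x) = u(|x|) belongs to C⁴(ℝ⁷), with ‖ũ‖ < ∞, and suppose lim_{ρ→∞} ρ³ |Δ_rad u(ρ)| = 0, lim_{ρ→∞} ρ³ |(Δ_rad u)'(ρ)| = 0, lim_{ρ→∞} ρ^{3/2} |u(ρ)| = 0, and lim_{ρ→∞} ρ^{5/2} |u'(ρ)| = 0. Then for each admissible α there is a constant C_α > 0, independent of u, such that: sup_{ρ>0} ρ^α |u(ρ)| ≤ C_α ‖ũ‖ for α ∈ [0,3/2]; sup_{ρ>0} ρ^α |u'(ρ)| ≤ C_α ‖ũ‖ for α ∈ [1,5/2]; sup_{ρ>0} ρ^α |Δ_rad u(ρ)| ≤ C_α ‖ũ‖ for α ∈ [2,3]; and sup_{ρ>0} ρ³ |(Δ_rad u)'(ρ)| ≤ C ‖ũ‖. -/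
open MeasureTheory Set Filter Topology
open scoped ENNReal

/-- The norm `‖ũ‖` itself (a real number, meaningful when `radHnormSq u < ⊤`). -/
noncomputable def radHnorm (u : ℝ → ℝ) : ℝ := Real.sqrt (radHnormSq u).toReal

lemma aux_int (F F' g : ℝ → ℝ) (c M : ℝ) (hc : 0 ≤ c) (hM0 : 0 ≤ M)
    (hF : ∀ r, 0 < r → HasDerivAt F (F' r) r)
    (hg : ContinuousOn g (Ioi 0)) (hg0 : ∀ r, 0 < r → 0 ≤ g r)
    (hle : ∀ r, 0 < r → F' r ≤ c * g r)
    (hM : ∫⁻ r in Ioi (0:ℝ), ENNReal.ofReal (g r) ≤ ENNReal.ofReal M)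
    (a b : ℝ) (ha : 0 < a) (hab : a ≤ b) : F b - F a ≤ c * M := by
  have hsub : Icc a b ⊆ Ioi (0:ℝ) := fun x hx => lt_of_lt_of_le ha hx.1
  have hgI : IntegrableOn g (Icc a b) := (hg.mono hsub).integrableOn_Icc
  have h1 : F b - F a ≤ ∫ y in a..b, c * g y := by
    apply intervalIntegral.sub_le_integral_of_hasDeriv_right_of_le hab
      (g' := F')
    · exact fun x hx => (hF x (hsub hx)).continuousAt.continuousWithinAt
    · exact fun x hx => (hF x (ha.trans hx.1)).hasDerivWithinAt
    · exact hgI.const_mul c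
    · exact fun x hx => hle x (ha.trans hx.1)
  have h2 : ∫ y in a..b, g y ≤ M := by
    rw [intervalIntegral.integral_of_le hab]
    have hI : IntegrableOn g (Ioc a b) := hgI.mono_set Ioc_subset_Icc_self
    rw [integral_eq_lintegral_of_nonneg_ae]
    · apply ENNReal.toReal_le_of_le_ofReal hM0
      refine le_trans (lintegral_mono_set ?_) hM
      exact fun x hx => ha.trans hx.1
    · refine (ae_restrict_iff' measurableSet_Ioc).2 (Eventually.of_forall fun x hx => ?_)
      exact hg0 x (ha.trans hx.1)
    · exact hI.aestronglyMeasurable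
  rw [intervalIntegral.integral_const_mul] at h1
  exact h1.trans (mul_le_mul_of_nonneg_left h2 hc)

lemma le_of_zero (F : ℝ → ℝ) (K b : ℝ) (hb : 0 < b)
    (h : ∀ a, 0 < a → a ≤ b → F b - F a ≤ K) (h0 : Tendsto F (𝓝[>] 0) (𝓝 0)) : F b ≤ K := by
  have : Tendsto (fun a => F b - F a) (𝓝[>] 0) (𝓝 (F b - 0)) := tendsto_const_nhds.sub h0
  rw [sub_zero] at this
  refine le_of_tendsto this ?_
  filter_upwards [Ioc_mem_nhdsGT hb] with a ha using h a ha.1 ha.2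

lemma mono_aux (F F' : ℝ → ℝ) (hF : ∀ r, 0 < r → HasDerivAt F (F' r) r)
    (hle : ∀ r, 0 < r → F' r ≤ 0) (a b : ℝ) (ha : 0 < a) (hab : a ≤ b) : F b ≤ F a := by
  have := aux_int F F' (fun _ => 0) 0 0 le_rfl le_rfl hF continuousOn_const
    (fun _ _ => le_rfl) (by simpa using hle) (by simp) a b ha hab
  linarith

lemma decay_one (g g' : ℝ → ℝ) (K : ℝ) (hg : ∀ r, 0 < r → HasDerivAt g (g' r) r)
    (hb : ∀ r, 0 < r → -g' r ≤ K * r ^ (-(5/2):ℝ)) (h0 : Tendsto g atTop (𝓝 0))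
    (r : ℝ) (hr : 0 < r) : g r ≤ (2/3) * K * r ^ (-(3/2):ℝ) := by
  set F : ℝ → ℝ := fun r => (2/3) * K * r ^ (-(3/2):ℝ) - g r with hFdef
  have hF : ∀ r, 0 < r → HasDerivAt F (-K * r ^ (-(5/2):ℝ) - g' r) r := by
    intro r hr
    have h := ((Real.hasDerivAt_rpow_const (p := (-(3/2):ℝ)) (Or.inl hr.ne')).const_mul
      ((2/3) * K)).sub (hg r hr)
    refine h.congr_deriv ?_
    rw [show (-(3/2):ℝ) - 1 = -(5/2) by norm_num]; ring
  have hlim : Tendsto F atTop (𝓝 0) := by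
    have := ((tendsto_rpow_neg_atTop (show (0:ℝ) < 3/2 by norm_num)).const_mul
      ((2/3) * K)).sub h0
    simpa using this
  have : (0:ℝ) ≤ F r := by
    refine le_of_tendsto hlim ?_
    filter_upwards [eventually_ge_atTop r] with b hb'
    exact mono_aux F _ hF (fun r hr => by linarith [hb r hr]) r b hr hb'
  simp only [hFdef] at this
  linarith

lemma decay (g g' : ℝ → ℝ) (K : ℝ) (hg : ∀ r, 0 < r → HasDerivAt g (g' r) r)
    (hb : ∀ r, 0 < r → |g' r| ≤ K * r ^ (-(5/2):ℝ)) (h0 : Tendsto g atTop (𝓝 0))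
    (r : ℝ) (hr : 0 < r) : |g r| ≤ (2/3) * K * r ^ (-(3/2):ℝ) := by
  rw [abs_le']
  refine ⟨decay_one g g' K hg (fun r hr => (neg_le_abs _).trans (hb r hr)) h0 r hr, ?_⟩
  exact decay_one (fun x => - g x) (fun x => - g' x) K (fun r hr => (hg r hr).neg)
    (fun r hr => by rw [neg_neg]; exact (le_abs_self _).trans (hb r hr)) (by simpa using h0.neg) r hr

lemma abs_le_of_sq5 (x N r : ℝ) (hN : 0 ≤ N) (hr : 0 < r) (h : r^5 * x^2 ≤ N^2) :
    |x| ≤ N * r ^ (-(5/2):ℝ) := by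
  apply abs_le_of_sq_le_sq _ (by positivity)
  rw [mul_pow, ← Real.rpow_natCast (r ^ (-(5/2):ℝ)), ← Real.rpow_mul hr.le]
  rw [show (-(5/2):ℝ) * ((2:ℕ):ℝ) = -((5:ℕ):ℝ) by norm_num, Real.rpow_neg hr.le, Real.rpow_natCast]
  rw [← div_eq_mul_inv, le_div_iff₀ (by positivity)]
  linarith

lemma grow_one (y z : ℝ → ℝ) (K : ℝ) 
    (hy : ∀ r, 0 < r → HasDerivAt y (z r - 6 / r * y r) r)
    (hz : ∀ r, 0 < r → z r ≤ K * r ^ (-(3/2):ℝ))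
    (h0 : Tendsto (fun r => r^6 * y r) (𝓝[>] 0) (𝓝 0))
    (r : ℝ) (hr : 0 < r) : y r ≤ (2/11) * K * r ^ (-(1/2):ℝ) := by
  set F : ℝ → ℝ := fun r => r^6 * y r - (2/11) * K * r ^ (11/2:ℝ) with hFdef
  have hF : ∀ r, 0 < r → HasDerivAt F (r^6 * (z r - K * r ^ (-(3/2):ℝ))) r := by
    intro r hr
    have h := ((hasDerivAt_pow 6 r).mul (hy r hr)).sub
      ((Real.hasDerivAt_rpow_const (p := (11/2:ℝ)) (Or.inl hr.ne')).const_mul ((2/11) * K))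
    refine h.congr_deriv ?_
    have : r ^ ((11/2:ℝ) - 1) = r^6 * r ^ (-(3/2):ℝ) := by
      rw [← Real.rpow_natCast, ← Real.rpow_add hr]; norm_num
    rw [this]; field_simp; ring
  have hlim : Tendsto F (𝓝[>] 0) (𝓝 0) := by
    have h1 : Tendsto (fun r : ℝ => r ^ (11/2:ℝ)) (𝓝[>] 0) (𝓝 0) := by
      have : ContinuousAt (fun r : ℝ => r ^ (11/2:ℝ)) 0 :=
        Real.continuousAt_rpow_const _ _ (Or.inr (by norm_num))
      have h := this.tendsto
      rw [Real.zero_rpow (by norm_num)] at h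
      exact h.mono_left nhdsWithin_le_nhds
    simpa using h0.sub (h1.const_mul ((2/11) * K))
  have h1 : F r ≤ 0 := by
    refine le_of_zero F 0 r hr (fun a ha hab => ?_) hlim
    have := mono_aux F _ hF (fun r hr => ?_) a r ha hab
    · linarith
    · exact mul_nonpos_of_nonneg_of_nonpos (by positivity) (by linarith [hz r hr])
  have h2 : r ^ (11/2:ℝ) = r^6 * r ^ (-(1/2):ℝ) := by
    rw [← Real.rpow_natCast, ← Real.rpow_add hr]; norm_num
  simp only [hFdef, h2] at h1
  have h3 : r^6 * y r ≤ r^6 * ((2/11) * K * r ^ (-(1/2):ℝ)) := by linarith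
  exact le_of_mul_le_mul_left h3 (by positivity)

lemma grow (y z : ℝ → ℝ) (K : ℝ) 
    (hy : ∀ r, 0 < r → HasDerivAt y (z r - 6 / r * y r) r)
    (hz : ∀ r, 0 < r → |z r| ≤ K * r ^ (-(3/2):ℝ))
    (h0 : Tendsto (fun r => r^6 * y r) (𝓝[>] 0) (𝓝 0))
    (r : ℝ) (hr : 0 < r) : |y r| ≤ (2/11) * K * r ^ (-(1/2):ℝ) := by
  rw [abs_le']
  refine ⟨grow_one y z K hy (fun r hr => (le_abs_self _).trans (hz r hr)) h0 r hr, ?_⟩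
  exact grow_one (fun x => - y x) (fun x => - z x) K
    (fun r hr => (hy r hr).neg.congr_deriv (by ring))
    (fun r hr => (neg_le_abs _).trans (hz r hr)) (by simpa using h0.neg) r hr

lemma near_one (g g' : ℝ → ℝ) (K : ℝ) (hK : 0 ≤ K) (hg : ∀ r, 0 < r → HasDerivAt g (g' r) r)
    (hb : ∀ r, 0 < r → -g' r ≤ K * r ^ (-(1/2):ℝ))
    (r : ℝ) (hr : 0 < r) (hr1 : r ≤ 1) : g r ≤ g 1 + 2 * K := by
  set F : ℝ → ℝ := fun r => -g r - 2 * K * r ^ (1/2:ℝ) with hFdef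
  have hF : ∀ r, 0 < r → HasDerivAt F (-g' r - K * r ^ (-(1/2):ℝ)) r := by
    intro r hr
    have h := (hg r hr).neg.sub ((Real.hasDerivAt_rpow_const (p := (1/2:ℝ))
      (Or.inl hr.ne')).const_mul (2 * K))
    refine h.congr_deriv ?_
    rw [show (1/2:ℝ) - 1 = -(1/2) by norm_num]; ring
  have h := mono_aux F _ hF (fun r hr => by linarith [hb r hr]) r 1 hr hr1
  simp only [hFdef, Real.one_rpow] at h
  have : 0 ≤ K * r ^ (1/2:ℝ) := by positivity
  linarith

lemma near (g g' : ℝ → ℝ) (K : ℝ) (hK : 0 ≤ K) (hg : ∀ r, 0 < r → HasDerivAt g (g' r) r)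
    (hb : ∀ r, 0 < r → |g' r| ≤ K * r ^ (-(1/2):ℝ))
    (r : ℝ) (hr : 0 < r) (hr1 : r ≤ 1) : |g r| ≤ |g 1| + 2 * K := by
  rw [abs_le']
  constructor
  · have := near_one g g' K hK hg (fun r hr => (neg_le_abs _).trans (hb r hr)) r hr hr1
    linarith [le_abs_self (g 1)]
  · have := near_one (fun x => - g x) (fun x => - g' x) K hK (fun r hr => (hg r hr).neg)
      (fun r hr => by rw [neg_neg]; exact (le_abs_self _).trans (hb r hr)) r hr hr1
    linarith [neg_le_abs (g 1)]

/-- All the regularity information that is used. -/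
lemma regularity (u : ℝ → ℝ)
    (h : ContDiff ℝ 4 (fun x : EuclideanSpace ℝ (Fin 7) => u ‖x‖)) :
    ContDiffOn ℝ 4 u (Ioi 0) ∧
    (∃ A B D : ℝ → ℝ, Continuous A ∧ Continuous B ∧ Continuous D ∧ ∀ r, 0 < r →
      deriv u r = A r ∧ r * radLap u r = B r ∧ r^2 * deriv (radLap u) r = D r) := by
  set e : EuclideanSpace ℝ (Fin 7) := EuclideanSpace.single 0 1 with he
  have hen : ‖e‖ = 1 := by simp [he]
  set v : ℝ → ℝ := fun r => u ‖r • e‖ with hv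
  have hvC : ContDiff ℝ 4 v := h.comp (contDiff_id.smul contDiff_const)
  have huv : ∀ r, 0 < r → u r = v r := by
    intro r hr; simp [hv, norm_smul, hen, abs_of_pos hr]
  have hev : ∀ r, 0 < r → u =ᶠ[𝓝 r] v := fun r hr => by
    filter_upwards [Ioi_mem_nhds hr] with x hx using huv x hx
  have hv1 : ContDiff ℝ 3 (deriv v) := by
    have : ContDiff ℝ (3+1) v := by exact_mod_cast hvC
    exact (contDiff_succ_iff_deriv.1 this).2.2
  have hv2 : ContDiff ℝ 2 (deriv (deriv v)) := by
    have : ContDiff ℝ (2+1) (deriv v) := by exact_mod_cast hv1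
    exact (contDiff_succ_iff_deriv.1 this).2.2
  have hv3 : ContDiff ℝ 1 (deriv (deriv (deriv v))) := by
    have : ContDiff ℝ (1+1) (deriv (deriv v)) := by exact_mod_cast hv2
    exact (contDiff_succ_iff_deriv.1 this).2.2
  have hw : ∀ r, 0 < r → radLap u r = deriv (deriv v) r + 6 / r * deriv v r := by
    intro r hr
    rw [radLap, (hev r hr).deriv.deriv_eq, (hev r hr).deriv_eq]
  refine ⟨hvC.contDiffOn.congr fun r hr => huv r hr, deriv v,
    fun r => r * deriv (deriv v) r + 6 * deriv v r,
    fun r => r^2 * deriv (deriv (deriv v)) r + 6 * r * deriv (deriv v) r - 6 * deriv v r,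
    hv1.continuous, ?_, ?_, ?_⟩
  · have := hv1.continuous; have := hv2.continuous; fun_prop
  · have := hv1.continuous; have := hv2.continuous; have := hv3.continuous; fun_prop
  · intro r hr
    refine ⟨(hev r hr).deriv_eq, ?_, ?_⟩
    · rw [hw r hr]; field_simp
    · have h1 : radLap u =ᶠ[𝓝 r] fun r => deriv (deriv v) r + 6 / r * deriv v r := by
        filter_upwards [Ioi_mem_nhds hr] with x hx using hw x hx
      have d1 := (hv1.differentiable (by norm_num) r).hasDerivAt
      have d2 := (hv2.differentiable (by norm_num) r).hasDerivAt
      have d3 : HasDerivAt (fun r : ℝ => 6 / r) (-6 / r^2) r := by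
        have := (hasDerivAt_inv hr.ne').const_mul 6
        refine this.congr_deriv ?_
        ring
      have d4 : deriv (fun r => deriv (deriv v) r + 6 / r * deriv v r) r = _ :=
        (d2.add (d3.mul d1)).deriv
      rw [h1.deriv_eq, d4]
      field_simp
      ring

lemma key (u : ℝ → ℝ) (hu : Good u) : 0 ≤ radHnorm u ∧ ∀ r, 0 < r →
    r^6 * (radLap u r)^2 ≤ 3 * (radHnorm u)^2 ∧
    r^6 * (deriv (radLap u) r)^2 ≤ 3 * (radHnorm u)^2 ∧
    |radLap u r| ≤ radHnorm u * r ^ (-(3/2):ℝ) ∧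
    |deriv u r| ≤ radHnorm u * r ^ (-(5/2):ℝ) ∧
    |deriv u r| ≤ radHnorm u * r ^ (-(1/2):ℝ) ∧
    |u r| ≤ radHnorm u * r ^ (-(3/2):ℝ) ∧
    (r ≤ 1 → |u r| ≤ 3 * radHnorm u) := by
  obtain ⟨hC, hfin, hw0, hp0, hu0, -⟩ := hu
  obtain ⟨hreg, A, B, D, hA, hB, hD, hABD⟩ := regularity u hC
  have hN0 : 0 ≤ radHnorm u := Real.sqrt_nonneg _
  have hNsq : ENNReal.ofReal ((radHnorm u)^2) = radHnormSq u := by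
    rw [radHnorm, Real.sq_sqrt ENNReal.toReal_nonneg, ENNReal.ofReal_toReal hfin.ne]
  set N := radHnorm u with hN
  -- regularity on the half line
  have hu1 : ContDiffOn ℝ 3 (deriv u) (Ioi 0) := hreg.deriv_of_isOpen isOpen_Ioi (by norm_num)
  have hu2 : ContDiffOn ℝ 2 (deriv (deriv u)) (Ioi 0) :=
    hu1.deriv_of_isOpen isOpen_Ioi (by norm_num)
  have hdiv : ContDiffOn ℝ 2 (fun r : ℝ => 6 / r) (Ioi 0) :=
    contDiffOn_const.div contDiffOn_id (fun x hx => ne_of_gt hx)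
  have hw : ContDiffOn ℝ 2 (radLap u) (Ioi 0) :=
    hu2.add (hdiv.mul (hu1.of_le (by norm_num)))
  have hw1 : ContDiffOn ℝ 1 (deriv (radLap u)) (Ioi 0) :=
    hw.deriv_of_isOpen isOpen_Ioi (by norm_num)
  have hw2 : ContDiffOn ℝ 0 (deriv (deriv (radLap u))) (Ioi 0) :=
    hw1.deriv_of_isOpen isOpen_Ioi (by norm_num)
  have hq : ContinuousOn (radLap (radLap u)) (Ioi 0) :=
    hw2.continuousOn.add (hdiv.continuousOn.mul hw1.continuousOn)
  have hda : ∀ (f : ℝ → ℝ) (n : WithTop ℕ∞), n ≠ 0 → ContDiffOn ℝ n f (Ioi 0) → ∀ r, 0 < r →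
      HasDerivAt f (deriv f r) r := fun f n hn hf r hr =>
    ((hf.differentiableOn hn).differentiableAt (Ioi_mem_nhds hr)).hasDerivAt
  have du : ∀ r, 0 < r → HasDerivAt u (deriv u r) r := hda u 4 (by norm_num) hreg
  have du1 : ∀ r, 0 < r → HasDerivAt (deriv u) (radLap u r - 6 / r * deriv u r) r :=
    fun r hr => (hda _ 3 (by norm_num) hu1 r hr).congr_deriv (by rw [radLap]; ring)
  have dw : ∀ r, 0 < r → HasDerivAt (radLap u) (deriv (radLap u) r) r :=
    hda _ 2 (by norm_num) hw
  have dw1 : ∀ r, 0 < r → HasDerivAt (deriv (radLap u))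
      (radLap (radLap u) r - 6 / r * deriv (radLap u) r) r :=
    fun r hr => (hda _ 1 (by norm_num) hw1 r hr).congr_deriv
      (by rw [radLap.eq_1 (radLap u)]; ring)
  clear hda hw2 hw1 hu1 hu2 hreg hdiv
  have hwc := hw.continuousOn
  clear hw
  set g : ℝ → ℝ := fun r => (radLap u r)^2 * r^6 + (radLap (radLap u) r)^2 * r^6 with hg
  have hgM : ∫⁻ r in Ioi (0:ℝ), ENNReal.ofReal (g r) ≤ ENNReal.ofReal (N^2) := by
    rw [hNsq, radHnormSq, ← lintegral_add_left']
    · exact lintegral_mono fun r => ENNReal.ofReal_add_le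
    · apply AEMeasurable.ennreal_ofReal
      exact ((hwc.pow 2).mul (continuousOn_id.pow 6)).aemeasurable measurableSet_Ioi
  have hgc : ContinuousOn g (Ioi 0) :=
    ((hwc.pow 2).mul (continuousOn_id.pow 6)).add ((hq.pow 2).mul (continuousOn_id.pow 6))
  have hg0 : ∀ r, 0 < r → 0 ≤ g r := fun r hr => by simp only [hg]; positivity
  have hN2 : 0 ≤ N^2 := sq_nonneg N
  clear hNsq hfin hC hq hwc
  set w := radLap u with hwdef
  set p := deriv w with hpdef
  set q := radLap w with hqdef
  set y := deriv u with hydef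
  -- limits at zero
  have lim0 : ∀ G : ℝ → ℝ, ∀ H : ℝ → ℝ, Continuous G → G 0 = 0 → (∀ r, 0 < r → H r = G r) →
      Tendsto H (𝓝[>] 0) (𝓝 0) := by
    intro G H hGc hG0 hHG
    have h1 : Tendsto G (𝓝[>] 0) (𝓝 0) := by
      have := hGc.tendsto 0
      rw [hG0] at this
      exact this.mono_left nhdsWithin_le_nhds
    refine h1.congr' ?_
    filter_upwards [self_mem_nhdsWithin] with r hr using (hHG r hr).symm
  -- (1)
  have P5 : ∀ r, 0 < r → r^5 * (p r)^2 ≤ N^2 := by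
    intro r hr
    refine le_of_zero (fun r => r^5 * (p r)^2) _ r hr (fun a ha hab => ?_)
      (lim0 (fun r => r * (D r)^2) _ (by fun_prop) (by simp)
        (fun r hr => by rw [← (hABD r hr).2.2]; ring))
    rw [← one_mul (N^2)]
    refine aux_int (fun r => r^5 * (p r)^2) (fun r => 2 * r^5 * p r * q r - 7 * r^4 * (p r)^2)
      g 1 _ zero_le_one hN2 (fun r hr => ?_) hgc hg0 (fun r hr => ?_) hgM a r ha hab
    · refine ((hasDerivAt_pow 5 r).mul ((dw1 r hr).pow 2)).congr_deriv ?_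
      simp only [Pi.pow_apply]
      field_simp
      ring
    · simp only [hg]
      have : 0 ≤ (w r)^2 * r^6 := by positivity
      have : 0 ≤ r^4 * (p r)^2 := by positivity
      nlinarith [sq_nonneg (r^2 * p r - r^3 * q r)]
  have Y5 : ∀ r, 0 < r → r^5 * (y r)^2 ≤ N^2 := by
    intro r hr
    refine le_of_zero (fun r => r^5 * (y r)^2) _ r hr (fun a ha hab => ?_)
      (lim0 (fun r => r^5 * (A r)^2) _ (by fun_prop) (by simp)
        (fun r hr => by rw [← (hABD r hr).1]))
    rw [← one_mul (N^2)]
    refine aux_int (fun r => r^5 * (y r)^2) (fun r => 2 * r^5 * y r * w r - 7 * r^4 * (y r)^2)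
      g 1 _ zero_le_one hN2 (fun r hr => ?_) hgc hg0 (fun r hr => ?_) hgM a r ha hab
    · refine ((hasDerivAt_pow 5 r).mul ((du1 r hr).pow 2)).congr_deriv ?_
      simp only [Pi.pow_apply]
      field_simp
      ring
    · simp only [hg]
      have : 0 ≤ (q r)^2 * r^6 := by positivity
      have : 0 ≤ r^4 * (y r)^2 := by positivity
      nlinarith [sq_nonneg (r^2 * y r - r^3 * w r)]
  have F6 : ∀ r, 0 < r → r^6 * (p r)^2 - r^6 * w r * p r ≤ 3/2 * N^2 := by
    intro r hr
    refine le_of_zero (fun r => r^6 * (p r)^2 - r^6 * w r * p r) _ r hr (fun a ha hab => ?_)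
      (lim0 (fun r => r^2 * (D r)^2 - r^3 * B r * D r) _ (by fun_prop) (by simp)
        (fun r hr => by rw [← (hABD r hr).2.2, ← (hABD r hr).2.1]; ring))
    refine aux_int (fun r => r^6 * (p r)^2 - r^6 * w r * p r)
      (fun r => 2 * r^6 * p r * q r - 6 * r^5 * (p r)^2 - r^6 * (p r)^2 - r^6 * w r * q r)
      g (3/2) _ (by norm_num) hN2 (fun r hr => ?_) hgc hg0 (fun r hr => ?_) hgM a r ha hab
    · refine (((hasDerivAt_pow 6 r).mul ((dw1 r hr).pow 2)).sub
        (((hasDerivAt_pow 6 r).mul (dw r hr)).mul (dw1 r hr))).congr_deriv ?_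
      simp only [Pi.pow_apply, Pi.mul_apply]
      field_simp
      ring
    · simp only [hg]
      have : 0 ≤ r^5 * (p r)^2 := by positivity
      have : 0 ≤ (w r)^2 * r^6 := by positivity
      nlinarith [sq_nonneg (r^3 * p r - r^3 * q r), sq_nonneg (r^3 * w r + r^3 * q r)]
  have H6 : ∀ r, 0 < r → r^6 * (w r)^2 + r^6 * w r * p r ≤ 3/2 * N^2 := by
    intro r hr
    set F : ℝ → ℝ := fun r => r^6 * (w r)^2 + r^6 * w r * p r with hF
    have hlim : Tendsto F atTop (𝓝 0) := by
      have a1 : Tendsto (fun r : ℝ => r^3 * w r) atTop (𝓝 0) := by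
        refine squeeze_zero_norm' ?_ hw0
        filter_upwards [eventually_gt_atTop 0] with x hx
        rw [Real.norm_eq_abs, abs_mul, abs_of_pos (by positivity : 0 < x^3)]
      have a2 : Tendsto (fun r : ℝ => r^3 * p r) atTop (𝓝 0) := by
        refine squeeze_zero_norm' ?_ hp0
        filter_upwards [eventually_gt_atTop 0] with x hx
        rw [Real.norm_eq_abs, abs_mul, abs_of_pos (by positivity : 0 < x^3)]
      have := (a1.mul a1).add (a1.mul a2)
      simp only [mul_zero, add_zero] at this
      refine this.congr fun x => ?_
      simp only [hF]; ring
    have hl : Tendsto (fun b => F r - F b) atTop (𝓝 (F r - 0)) := tendsto_const_nhds.sub hlim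
    rw [sub_zero] at hl
    refine le_of_tendsto hl ?_
    filter_upwards [eventually_ge_atTop r] with b hb
    have := aux_int (fun r => - F r)
      (fun r => -6 * r^5 * (w r)^2 - 2 * r^6 * w r * p r
        - r^6 * (p r)^2 - r^6 * w r * q r)
      g (3/2) _ (by norm_num) hN2 (fun r hr => ?_) hgc hg0 (fun r hr => ?_) hgM r b hr hb
    · linarith
    · refine (((hasDerivAt_pow 6 r).mul ((dw r hr).pow 2)).add
        (((hasDerivAt_pow 6 r).mul (dw r hr)).mul (dw1 r hr))).neg.congr_deriv ?_
      simp only [Pi.pow_apply, Pi.mul_apply]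
      field_simp
      ring
    · simp only [hg]
      have : 0 ≤ r^5 * (w r)^2 := by positivity
      have : 0 ≤ (q r)^2 * r^6 := by positivity
      nlinarith [sq_nonneg (r^3 * w r + r^3 * p r), sq_nonneg (r^3 * w r + r^3 * q r)]
  have wlim : Tendsto w atTop (𝓝 0) := by
    refine squeeze_zero_norm' ?_ hw0
    filter_upwards [eventually_ge_atTop 1] with x hx
    rw [Real.norm_eq_abs]
    exact le_mul_of_one_le_left (abs_nonneg _) (one_le_pow₀ hx)
  have ulim : Tendsto u atTop (𝓝 0) := by
    refine squeeze_zero_norm' ?_ hu0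
    filter_upwards [eventually_ge_atTop 1] with x hx
    rw [Real.norm_eq_abs]
    exact le_mul_of_one_le_left (abs_nonneg _) (Real.one_le_rpow hx (by norm_num))
  have Y : ∀ r, 0 < r → |y r| ≤ N * r ^ (-(5/2):ℝ) :=
    fun r hr => abs_le_of_sq5 _ _ _ hN0 hr (Y5 r hr)
  have red : ∀ (x s c : ℝ), 0 < s → 0 ≤ c → c ≤ 1 → x ≤ c * N * s → x ≤ N * s := by
    intro x s c hs hc hc1 hx
    refine hx.trans (mul_le_mul_of_nonneg_right ?_ hs.le)
    nlinarith
  have W : ∀ r, 0 < r → |w r| ≤ N * r ^ (-(3/2):ℝ) := fun r hr =>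
    red _ _ (2/3) (by positivity) (by norm_num) (by norm_num)
      (decay w p N dw (fun r hr => abs_le_of_sq5 _ _ _ hN0 hr (P5 r hr)) wlim r hr)
  have U : ∀ r, 0 < r → |u r| ≤ N * r ^ (-(3/2):ℝ) := fun r hr =>
    red _ _ (2/3) (by positivity) (by norm_num) (by norm_num)
      (decay u y N du Y ulim r hr)
  have Y1 : ∀ r, 0 < r → |y r| ≤ N * r ^ (-(1/2):ℝ) := fun r hr =>
    red _ _ (2/11) (by positivity) (by norm_num) (by norm_num)
      (grow y w N du1 W (lim0 (fun r => r^6 * A r) _ (by fun_prop) (by simp)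
        (fun r hr => by rw [← (hABD r hr).1])) r hr)
  refine ⟨hN0, fun r hr => ⟨?_, ?_, W r hr, Y r hr, Y1 r hr, U r hr, fun hr1 => ?_⟩⟩
  · have : 0 ≤ r^6 * (p r)^2 := by positivity
    linarith [F6 r hr, H6 r hr]
  · have : 0 ≤ r^6 * (w r)^2 := by positivity
    linarith [F6 r hr, H6 r hr]
  · have h1 := near u y N hN0 du Y1 r hr hr1
    have h2 := U 1 one_pos
    rw [Real.one_rpow] at h2
    linarith

lemma interp_s4 (r α a b : ℝ) (hr : 0 < r) (ha : a ≤ α) (hb : α ≤ b) : r ^ α ≤ r ^ a + r ^ b := by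
  rcases le_total r 1 with h | h
  · have := Real.rpow_le_rpow_of_exponent_ge hr h ha
    have : 0 < r ^ b := by positivity
    linarith
  · have := Real.rpow_le_rpow_of_exponent_le h hb
    have : 0 < r ^ a := by positivity
    linarith

lemma mul_le_of (r x N a : ℝ) (hr : 0 < r) (h : x ≤ N * r ^ (-a)) : r ^ a * x ≤ N := by
  have h1 := mul_le_mul_of_nonneg_left h (by positivity : 0 ≤ r ^ a)
  have h2 : r ^ a * r ^ (-a) = 1 := by rw [← Real.rpow_add hr]; simp
  calc _ ≤ _ := h1
    _ = N * (r ^ a * r ^ (-a)) := by ring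
    _ = N := by rw [h2, mul_one]

lemma cube_le (r x N : ℝ) (hr : 0 < r) (hN : 0 ≤ N) (h : r^6 * x^2 ≤ 3 * N^2) :
    r ^ (3:ℝ) * |x| ≤ 2 * N := by
  rw [show (3:ℝ) = ((3:ℕ):ℝ) by norm_num, Real.rpow_natCast]
  refine (sq_le_sq₀ (by positivity) (by positivity)).1 ?_
  rw [mul_pow, sq_abs]
  nlinarith [sq_nonneg N]

/-- Weighted `L^∞(0,∞)` bounds: `sup_{ρ>0} ρ^α |u⁽ʲ⁾(ρ)| ≲_α ‖ũ‖` for the admissible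
ranges of `α`, together with the bounds on `Δ_rad u` and `(Δ_rad u)'`. -/
theorem stmt4 :
    (∀ α : ℝ, α ∈ Icc (0:ℝ) (3/2) → ∃ C : ℝ, 0 < C ∧ ∀ u : ℝ → ℝ, Good u →
      ∀ ρ : ℝ, 0 < ρ → ρ ^ α * |u ρ| ≤ C * radHnorm u) ∧
    (∀ α : ℝ, α ∈ Icc (1:ℝ) (5/2) → ∃ C : ℝ, 0 < C ∧ ∀ u : ℝ → ℝ, Good u →
      ∀ ρ : ℝ, 0 < ρ → ρ ^ α * |deriv u ρ| ≤ C * radHnorm u) ∧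
    (∀ α : ℝ, α ∈ Icc (2:ℝ) 3 → ∃ C : ℝ, 0 < C ∧ ∀ u : ℝ → ℝ, Good u →
      ∀ ρ : ℝ, 0 < ρ → ρ ^ α * |radLap u ρ| ≤ C * radHnorm u) ∧
    (∃ C : ℝ, 0 < C ∧ ∀ u : ℝ → ℝ, Good u →
      ∀ ρ : ℝ, 0 < ρ → ρ ^ (3:ℝ) * |deriv (radLap u) ρ| ≤ C * radHnorm u) := by
  refine ⟨fun α hα => ⟨3, by norm_num, fun u hu r hr => ?_⟩,
    fun α hα => ⟨2, by norm_num, fun u hu r hr => ?_⟩,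
    fun α hα => ⟨3, by norm_num, fun u hu r hr => ?_⟩,
    ⟨2, by norm_num, fun u hu r hr => ?_⟩⟩ <;>
  obtain ⟨hN, hk⟩ := key u hu <;>
  obtain ⟨k1, k2, k3, k4, k5, k6, k7⟩ := hk r hr
  · rcases le_total r 1 with h | h
    · have h1 : r ^ α ≤ 1 := Real.rpow_le_one hr.le h hα.1
      calc r ^ α * |u r| ≤ 1 * |u r| := mul_le_mul_of_nonneg_right h1 (abs_nonneg _)
        _ ≤ _ := by rw [one_mul]; exact k7 h
    · have h1 := Real.rpow_le_rpow_of_exponent_le h hα.2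
      have h2 := mul_le_of r _ _ (3/2) hr k6
      have h3 := mul_le_mul_of_nonneg_right h1 (abs_nonneg (u r))
      linarith
  · have h1 := interp_s4 r α (1/2) (5/2) hr (by linarith [hα.1]) hα.2
    have h2 := mul_le_of r _ _ (1/2) hr k5
    have h3 := mul_le_of r _ _ (5/2) hr k4
    have h4 := mul_le_mul_of_nonneg_right h1 (abs_nonneg (deriv u r))
    rw [add_mul] at h4
    linarith
  · have h1 := interp_s4 r α (3/2) 3 hr (by linarith [hα.1]) hα.2
    have h2 := mul_le_of r _ _ (3/2) hr k3
    have h3 := cube_le r _ _ hr hN k1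
    have h4 := mul_le_mul_of_nonneg_right h1 (abs_nonneg (radLap u r))
    rw [add_mul] at h4
    linarith
  · exact cube_le r _ _ hr hN k2
end

section
/- For every radial u ∈ C_c^∞(ℝ⁷, ℂ), setting L₀u(x) := Δu(x) − (1/2) x · ∇u(x) − u(x), one has Re[ (Δ(L₀u) | Δu)_{L²(ℝ⁷)} + (Δ²(L₀u) | Δ²u)_{L²(ℝ⁷)} ] ≤ −(1/4) ( ‖Δu‖²_{L²(ℝ⁷)} + ‖Δ²u‖²_{L²(ℝ⁷)} ). -/
open MeasureTheory

noncomputable section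

abbrev E7 := EuclideanSpace ℝ (Fin 7)

/-- The Laplacian on `ℝ⁷`: `Δf(x) = ∑ᵢ ∂ᵢ²f(x)`. -/
def lapC (f : E7 → ℂ) (x : E7) : ℂ :=
  ∑ i : Fin 7, iteratedFDeriv ℝ 2 f x ![EuclideanSpace.single i 1, EuclideanSpace.single i 1]

/-- A function on `ℝ⁷` is radial if it only depends on the norm of its argument. -/
def IsRadial (f : E7 → ℂ) : Prop := ∀ x y : E7, ‖x‖ = ‖y‖ → f x = f y

/-- The free Ornstein–Uhlenbeck-type operator `L₀u = Δu − (1/2)x·∇u − u`. -/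
def L0 (u : E7 → ℂ) (x : E7) : ℂ := lapC u x - (1/2 : ℂ) * fderiv ℝ u x x - u x

/-- Directional derivative. -/
def dirD (v : E7) (f : E7 → ℂ) (x : E7) : ℂ := fderiv ℝ f x v

/-- The dilation generator `x · ∇ f`. -/
def dilD (f : E7 → ℂ) (x : E7) : ℂ := fderiv ℝ f x x

/-- Standard basis vectors. -/
def bv (i : Fin 7) : E7 := EuclideanSpace.single i 1

lemma dirD_smooth (v : E7) {f : E7 → ℂ} (hf : ContDiff ℝ (⊤ : ℕ∞) f) :
    ContDiff ℝ (⊤ : ℕ∞) (dirD v f) := by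
  have h : ContDiff ℝ (⊤ : ℕ∞) (fderiv ℝ f) := hf.fderiv_right (by simp)
  exact h.clm_apply contDiff_const

lemma dilD_smooth {f : E7 → ℂ} (hf : ContDiff ℝ (⊤ : ℕ∞) f) :
    ContDiff ℝ (⊤ : ℕ∞) (dilD f) := by
  have h : ContDiff ℝ (⊤ : ℕ∞) (fderiv ℝ f) := hf.fderiv_right (by simp)
  exact h.clm_apply contDiff_id

lemma dirD_supp (v : E7) {f : E7 → ℂ} (hf : HasCompactSupport f) :
    HasCompactSupport (dirD v f) := hf.fderiv_apply (𝕜 := ℝ) v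

lemma dirD_add (v : E7) {f g : E7 → ℂ} (hf : ContDiff ℝ (⊤ : ℕ∞) f)
    (hg : ContDiff ℝ (⊤ : ℕ∞) g) :
    dirD v (fun x => f x + g x) = fun x => dirD v f x + dirD v g x := by
  ext x
  have h1 := hf.differentiable (by simp) x
  have h2 := hg.differentiable (by simp) x
  simp [dirD, fderiv_fun_add h1 h2]

lemma dirD_mul (v : E7) {f : E7 → ℂ} (c : ℂ) (hf : ContDiff ℝ (⊤ : ℕ∞) f) :
    dirD v (fun x => c * f x) = fun x => c * dirD v f x := by
  ext x
  have h1 := hf.differentiable (by simp) x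
  simp [dirD, fderiv_const_mul h1]

lemma lapC_eq {f : E7 → ℂ} (hf : ContDiff ℝ (⊤ : ℕ∞) f) :
    lapC f = fun x => ∑ i : Fin 7, dirD (bv i) (dirD (bv i) f) x := by
  ext x
  have h : ContDiff ℝ (⊤ : ℕ∞) (fderiv ℝ f) := hf.fderiv_right (by simp)
  have h1 := h.differentiable (by simp) x
  unfold lapC
  refine Finset.sum_congr rfl fun i _ => ?_
  rw [iteratedFDeriv_two_apply]
  unfold dirD
  rw [fderiv_clm_apply h1 (differentiableAt_const _)]
  simp [bv]

lemma lapC_smooth {f : E7 → ℂ} (hf : ContDiff ℝ (⊤ : ℕ∞) f) :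
    ContDiff ℝ (⊤ : ℕ∞) (lapC f) := by
  rw [lapC_eq hf]
  exact ContDiff.sum fun i _ => dirD_smooth _ (dirD_smooth _ hf)

lemma lapC_supp {f : E7 → ℂ} (hf : ContDiff ℝ (⊤ : ℕ∞) f) (hc : HasCompactSupport f) :
    HasCompactSupport (lapC f) := by
  have h : HasCompactSupport (iteratedFDeriv ℝ 2 f) := hc.iteratedFDeriv 2
  refine h.mono ?_
  intro x hx
  simp only [Function.mem_support] at hx ⊢
  intro h0
  exact hx (by simp [lapC, h0])

lemma lapC_add {f g : E7 → ℂ} (hf : ContDiff ℝ (⊤ : ℕ∞) f) (hg : ContDiff ℝ (⊤ : ℕ∞) g) :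
    lapC (fun x => f x + g x) = fun x => lapC f x + lapC g x := by
  rw [lapC_eq hf, lapC_eq hg, lapC_eq (hf.add hg)]
  ext x
  rw [← Finset.sum_add_distrib]
  refine Finset.sum_congr rfl fun i _ => ?_
  rw [dirD_add _ hf hg, dirD_add _ (dirD_smooth _ hf) (dirD_smooth _ hg)]

lemma lapC_mul {f : E7 → ℂ} (c : ℂ) (hf : ContDiff ℝ (⊤ : ℕ∞) f) :
    lapC (fun x => c * f x) = fun x => c * lapC f x := by
  rw [lapC_eq hf, lapC_eq (contDiff_const.mul hf)]
  ext x
  rw [Finset.mul_sum]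
  refine Finset.sum_congr rfl fun i _ => ?_
  rw [dirD_mul _ _ hf, dirD_mul _ _ (dirD_smooth _ hf)]

lemma dirD_dilD (v : E7) {f : E7 → ℂ} (hf : ContDiff ℝ (⊤ : ℕ∞) f) :
    dirD v (dilD f) = fun x => dirD v f x + dilD (dirD v f) x := by
  ext x
  have h : ContDiff ℝ (⊤ : ℕ∞) (fderiv ℝ f) := hf.fderiv_right (by simp)
  have h1 := h.differentiable (by simp) x
  have hs : IsSymmSndFDerivAt ℝ f x := 
    hf.contDiffAt.isSymmSndFDerivAt (by simp; exact WithTop.coe_le_coe.2 (le_top : (2 : ℕ∞) ≤ ⊤))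
  unfold dirD dilD
  rw [fderiv_clm_apply h1 differentiableAt_fun_id, fderiv_clm_apply h1 (differentiableAt_const _)]
  simp [hs v x]

lemma lapC_dilD {f : E7 → ℂ} (hf : ContDiff ℝ (⊤ : ℕ∞) f) :
    lapC (dilD f) = fun x => 2 * lapC f x + dilD (lapC f) x := by
  have key : ∀ i, dirD (bv i) (dirD (bv i) (dilD f)) = fun x =>
      2 * dirD (bv i) (dirD (bv i) f) x + dilD (dirD (bv i) (dirD (bv i) f)) x := by
    intro i
    have s1 := dirD_smooth (bv i) hf
    rw [dirD_dilD _ hf, dirD_add _ s1 (dilD_smooth s1), dirD_dilD _ s1]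
    ext x
    ring
  rw [lapC_eq (dilD_smooth hf), lapC_eq hf]
  ext x
  have : dilD (fun x => ∑ i : Fin 7, dirD (bv i) (dirD (bv i) f) x) x =
      ∑ i : Fin 7, dilD (dirD (bv i) (dirD (bv i) f)) x := by
    unfold dilD
    rw [fderiv_fun_sum]
    · simp
    · intro i _
      exact (dirD_smooth _ (dirD_smooth _ hf)).differentiable (by simp) x
  rw [this, Finset.mul_sum, ← Finset.sum_add_distrib]
  exact Finset.sum_congr rfl fun i _ => by rw [key i]

/-- `Δ - (1/2) x·∇ - c`. -/
def Lc (c : ℂ) (f : E7 → ℂ) (x : E7) : ℂ := lapC f x + ((-(1/2) : ℂ) * dilD f x + (-c) * f x)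

lemma lapC_Lc (c : ℂ) {f : E7 → ℂ} (hf : ContDiff ℝ (⊤ : ℕ∞) f) :
    lapC (Lc c f) = Lc (c + 1) (lapC f) := by
  unfold Lc
  have a := lapC_smooth hf
  have b := dilD_smooth hf
  rw [lapC_add a ((contDiff_const.mul b).add (contDiff_const.mul hf)),
    lapC_add (contDiff_const.mul b) (contDiff_const.mul hf), lapC_mul _ b, lapC_mul _ hf,
    lapC_dilD hf]
  ext x
  ring

lemma ibp_lap {w : E7 → ℂ} (hw : ContDiff ℝ (⊤ : ℕ∞) w) (hc : HasCompactSupport w) (v : E7) :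
    ∫ x, inner ℝ (w x) (dirD v (dirD v w) x) ≤ 0 := by
  have s1 := dirD_smooth v hw
  have s2 := dirD_smooth v s1
  have h := integral_bilinear_hasFDerivAt_right_eq_neg_left_of_integrable (μ := (volume : Measure E7))
    (f := w) (f' := fderiv ℝ w) (g := dirD v w) (g' := fderiv ℝ (dirD v w)) (v := v)
    (B := innerSL ℝ (E := ℂ)) ?_ ?_ ?_ ?_ ?_
  · change ∫ x, inner ℝ (w x) (dirD v (dirD v w) x) = - ∫ x, inner ℝ (dirD v w x) (dirD v w x) at h
    rw [h, neg_nonpos]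
    exact integral_nonneg fun x => real_inner_self_nonneg
  · change Integrable (fun x => inner ℝ (dirD v w x) (dirD v w x)) _
    refine (s1.continuous.inner s1.continuous).integrable_of_hasCompactSupport ?_
    exact (dirD_supp v hc).mono fun x hx h0 => hx (by simp [h0])
  · change Integrable (fun x => inner ℝ (w x) (dirD v (dirD v w) x)) _
    refine (hw.continuous.inner s2.continuous).integrable_of_hasCompactSupport ?_
    exact hc.mono fun x hx h0 => hx (by simp [h0])
  · change Integrable (fun x => inner ℝ (w x) (dirD v w x)) _
    refine (hw.continuous.inner s1.continuous).integrable_of_hasCompactSupport ?_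
    exact hc.mono fun x hx h0 => hx (by simp [h0])
  · exact fun x _ => (hw.differentiable (by simp) x).hasFDerivAt
  · exact fun x _ => (s1.differentiable (by simp) x).hasFDerivAt

lemma ibp_dil {w : E7 → ℂ} (hw : ContDiff ℝ (⊤ : ℕ∞) w) (hc : HasCompactSupport w) (i : Fin 7) :
    ∫ x : E7, x i * inner ℝ (w x) (dirD (bv i) w x) = -(1/2) * ∫ x, ‖w x‖^2 := by
  have s1 := dirD_smooth (bv i) hw
  have hp : Continuous (fun x : E7 => x i) := by fun_prop
  have h := integral_bilinear_hasFDerivAt_right_eq_neg_left_of_integrable (μ := (volume : Measure E7))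
    (f := fun x : E7 => x i) (f' := fun _ => (EuclideanSpace.proj i : E7 →L[ℝ] ℝ))
    (g := fun x => ‖w x‖^2) (g' := fun x => 2 • (innerSL ℝ (w x)).comp (fderiv ℝ w x)) (v := bv i)
    (B := ContinuousLinearMap.mul ℝ ℝ) ?_ ?_ ?_ ?_ ?_
  · have e1 : ∀ x : E7, ContinuousLinearMap.mul ℝ ℝ (x i)
        ((2 • (innerSL ℝ (w x)).comp (fderiv ℝ w x)) (bv i)) =
        2 * (x i * inner ℝ (w x) (dirD (bv i) w x)) := by
      intro x
      simp [dirD]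
      ring
    have e2 : ∀ x : E7, ContinuousLinearMap.mul ℝ ℝ
        ((EuclideanSpace.proj i : E7 →L[ℝ] ℝ) (bv i)) (‖w x‖^2) = ‖w x‖^2 := by
      intro x
      simp [bv]
    simp_rw [e1, e2] at h
    rw [integral_const_mul] at h
    linarith
  · refine Continuous.integrable_of_hasCompactSupport ?_ ?_
    · simp only [ContinuousLinearMap.mul_apply']
      exact continuous_const.mul (hw.continuous.norm.pow 2)
    · exact hc.mono fun x hx h0 => hx (by simp [h0])
  · refine Continuous.integrable_of_hasCompactSupport ?_ ?_
    · change Continuous (fun x : E7 => x i * (2 • inner ℝ (w x) (dirD (bv i) w x)))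
      exact hp.mul ((hw.continuous.inner s1.continuous).const_smul 2)
    · exact hc.mono fun x hx h0 => hx (by simp [h0])
  · refine Continuous.integrable_of_hasCompactSupport ?_ ?_
    · simp only [ContinuousLinearMap.mul_apply']
      exact hp.mul (hw.continuous.norm.pow 2)
    · exact hc.mono fun x hx h0 => hx (by simp [h0])
  · exact fun x _ => (EuclideanSpace.proj i : E7 →L[ℝ] ℝ).hasFDerivAt
  · exact fun x _ => (hw.differentiable (by simp) x).hasFDerivAt.norm_sq

lemma dilD_eq (f : E7 → ℂ) (x : E7) : dilD f x = ∑ i : Fin 7, x i • dirD (bv i) f x := by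
  have hx : x = ∑ i : Fin 7, x i • bv i := by
    ext j
    simp [bv, Finset.sum_apply, Pi.single_apply]
  unfold dilD dirD
  conv_lhs => rw [hx, map_sum, ← hx]
  simp

lemma main_est (c : ℝ) {w : E7 → ℂ} (hw : ContDiff ℝ (⊤ : ℕ∞) w) (hc : HasCompactSupport w) :
    (∫ x, Lc c w x * (starRingEnd ℂ) (w x)).re ≤ (7/4 - c) * ∫ x, ‖w x‖^2 := by
  have hL : Continuous (Lc c w) := by
    unfold Lc
    exact (lapC_smooth hw).continuous.add
      ((continuous_const.mul (dilD_smooth hw).continuous).add (continuous_const.mul hw.continuous))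
  have hI : Integrable (fun x => Lc c w x * (starRingEnd ℂ) (w x)) := by
    refine (hL.mul (Complex.continuous_conj.comp hw.continuous)).integrable_of_hasCompactSupport ?_
    exact hc.mono fun x hx h0 => hx (by simp [h0])
  have e0 := integral_re hI
  have e0' : (∫ x, Lc c w x * (starRingEnd ℂ) (w x)).re =
      ∫ x, (Lc c w x * (starRingEnd ℂ) (w x)).re := e0.symm
  have pt : ∀ x, (Lc c w x * (starRingEnd ℂ) (w x)).re =
      ∑ i : Fin 7, inner ℝ (w x) (dirD (bv i) (dirD (bv i) w) x) +
      (-(1/2) * (∑ i : Fin 7, x i * inner ℝ (w x) (dirD (bv i) w x)) + (-c) * ‖w x‖^2) := by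
    intro x
    have q1 : ∑ i : Fin 7, inner ℝ (w x) (dirD (bv i) (dirD (bv i) w) x) =
        inner ℝ (w x) (lapC w x) := by rw [lapC_eq hw, inner_sum]
    have q2 : ∑ i : Fin 7, x i * inner ℝ (w x) (dirD (bv i) w x) = inner ℝ (w x) (dilD w x) := by
      rw [dilD_eq, inner_sum]
      simp_rw [inner_smul_right]
    rw [q1, q2]
    have q3 : ‖w x‖^2 = (w x).re^2 + (w x).im^2 := by
      rw [Complex.sq_norm, Complex.normSq_apply]; ring
    rw [q3]
    simp [Lc, Complex.inner]
    ring
  have i1 : ∀ i : Fin 7, Integrable (fun x => inner ℝ (w x) (dirD (bv i) (dirD (bv i) w) x)) := by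
    intro i
    refine (hw.continuous.inner (dirD_smooth _ (dirD_smooth _ hw)).continuous).integrable_of_hasCompactSupport ?_
    exact hc.mono fun x hx h0 => hx (by simp [h0])
  have i2 : ∀ i : Fin 7, Integrable (fun x : E7 => x i * inner ℝ (w x) (dirD (bv i) w x)) := by
    intro i
    have hp : Continuous (fun x : E7 => x i) := by fun_prop
    refine (hp.mul (hw.continuous.inner (dirD_smooth _ hw).continuous)).integrable_of_hasCompactSupport ?_
    exact hc.mono fun x hx h0 => hx (by simp [h0])
  have i3 : Integrable (fun x => ‖w x‖^2) := by
    refine (hw.continuous.norm.pow 2).integrable_of_hasCompactSupport ?_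
    exact hc.mono fun x hx h0 => hx (by simp [h0])
  have I1 := integrable_finsetSum Finset.univ fun i _ => i1 i
  have I2 := (integrable_finsetSum Finset.univ fun i _ => i2 i).const_mul (-(1/2))
  have I3 := i3.const_mul (-c)
  have I4 : Integrable (fun x : E7 => -(1/2) * (∑ i : Fin 7, x i * inner ℝ (w x) (dirD (bv i) w x))
      + (-c) * ‖w x‖^2) := I2.add I3
  rw [e0']
  simp_rw [pt]
  rw [integral_add I1 I4, integral_add I2 I3, integral_const_mul, integral_const_mul,
    integral_finsetSum _ fun i _ => i1 i, integral_finsetSum _ fun i _ => i2 i]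
  simp_rw [ibp_dil hw hc]
  have n : ∑ i : Fin 7, ∫ x, inner ℝ (w x) (dirD (bv i) (dirD (bv i) w) x) ≤ 0 :=
    Finset.sum_nonpos fun i _ => ibp_lap hw hc (bv i)
  simp only [Finset.sum_const, Finset.card_univ, Fintype.card_fin, nsmul_eq_mul]
  push_cast
  linarith

/-- For radial `u ∈ C_c^∞(ℝ⁷, ℂ)`:
`Re[(Δ(L₀u)|Δu)_{L²} + (Δ²(L₀u)|Δ²u)_{L²}] ≤ −(1/4)(‖Δu‖²_{L²} + ‖Δ²u‖²_{L²})`. -/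
theorem stmt6 (u : E7 → ℂ) (hu : ContDiff ℝ (⊤ : ℕ∞) u) (hc : HasCompactSupport u)
    (hrad : IsRadial u) :
    ((∫ x : E7, lapC (L0 u) x * (starRingEnd ℂ) (lapC u x)) +
      ∫ x : E7, lapC (lapC (L0 u)) x * (starRingEnd ℂ) (lapC (lapC u) x)).re
      ≤ -(1/4) * ((∫ x : E7, ‖lapC u x‖^2) + ∫ x : E7, ‖lapC (lapC u) x‖^2) := by
  have hL : L0 u = Lc 1 u := by
    ext x
    simp only [L0, Lc, dilD]
    ring
  have s1 := lapC_smooth hu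
  have s2 := lapC_smooth s1
  have c1 := lapC_supp hu hc
  have c2 := lapC_supp s1 c1
  rw [hL, lapC_Lc _ hu, lapC_Lc _ s1, Complex.add_re]
  have m1 := main_est 2 s1 c1
  have m2 := main_est 3 s2 c2
  have t1 : ((2 : ℝ) : ℂ) = 1 + 1 := by norm_num
  have t2 : ((3 : ℝ) : ℂ) = 1 + 1 + 1 := by norm_num
  rw [t1] at m1
  rw [t2] at m2
  have p : 0 ≤ ∫ x : E7, ‖lapC (lapC u) x‖^2 := integral_nonneg fun x => by positivity
  linarith

end
end
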